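/- arXiv:2512.10759 — 12 statements merged into one kernel-verified Lean document; each statement's English description precedes it below -/
import Mathlib

section
/- Let U be a forward asymptotically compact process on a complete metric space X. Then for every bounded set B ⊆ X and every t₀ ∈ ℝ, the forward ω-limit set ω_f(B,t₀) is nonempty, compact, and forward attracts B, i.e. dist(U(t,t₀,B), ω_f(B,t₀)) → 0 as t → +∞. -/
open Filter Topology Set Metric Bornology ENNReal

variable {X : Type*} [MetricSpace X]

/-- Hausdorff semidistance `dist(A,B) = sup_{a ∈ A} inf_{b ∈ B} d(a,b)`,
valued in `ℝ≥0∞`. -/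
noncomputable def esemidist (A B : Set X) : ℝ≥0∞ :=
  ⨆ a : A, EMetric.infEdist (a : X) B

/-- Hausdorff distance `dist_H(A,B) = max{dist(A,B), dist(B,A)}`. -/
noncomputable def ehdist (A B : Set X) : ℝ≥0∞ :=
  max (esemidist A B) (esemidist B A)

/-- A (single-valued) process on `X`. -/
def IsProcess (U : ℝ → ℝ → X → X) : Prop :=
  (∀ (s : ℝ) (x : X), U s s x = x) ∧
  (∀ (t τ s : ℝ) (x : X), s ≤ τ → τ ≤ t → U t s x = U t τ (U τ s x)) ∧
  ContinuousOn (fun p : ℝ × ℝ × X => U p.1 p.2.1 p.2.2) {p : ℝ × ℝ × X | p.2.1 ≤ p.1}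

/-- The process `U` is forward asymptotically compact. -/
def FwdAsympCompact (U : ℝ → ℝ → X → X) : Prop :=
  ∀ (t₀ : ℝ) (B : Set X), IsBounded B →
    ∀ (t : ℕ → ℝ) (y : ℕ → X), Tendsto t atTop atTop →
      (∀ n, t₀ ≤ t n ∧ y n ∈ U (t n) t₀ '' B) →
      ∃ (φ : ℕ → ℕ) (z : X), StrictMono φ ∧ Tendsto (y ∘ φ) atTop (𝓝 z)

/-- Forward ω-limit set `ω_f(B,t₀)` of a set `B` for initial time `t₀`. -/
def omegaF (U : ℝ → ℝ → X → X) (B : Set X) (t₀ : ℝ) : Set X :=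
  {y | ∃ (t : ℕ → ℝ) (yn : ℕ → X), Tendsto t atTop atTop ∧
        (∀ n, t₀ ≤ t n ∧ yn n ∈ U (t n) t₀ '' B) ∧ Tendsto yn atTop (𝓝 y)}

/-- ω-limit set `ω(K)` of a family of sets `K = {K(t)}`. -/
def omegaFam (K : ℝ → Set X) : Set X :=
  {y | ∃ (t : ℕ → ℝ) (yn : ℕ → X), Tendsto t atTop atTop ∧
        (∀ n, yn n ∈ K (t n)) ∧ Tendsto yn atTop (𝓝 y)}

/-- The set `ω₀(K) = Liminf_{t → +∞} K(t)`. -/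
def omega0Fam (K : ℝ → Set X) : Set X :=
  {y | Tendsto (fun t => EMetric.infEdist y (K t)) atTop (𝓝 0)}

/-- The family `C = {C(t)}` pullback attracts every bounded set. -/
def PullbackAttracts (U : ℝ → ℝ → X → X) (C : ℝ → Set X) : Prop :=
  ∀ (t : ℝ) (B : Set X), IsBounded B →
    Tendsto (fun t₀ => esemidist (U t t₀ '' B) (C t)) atBot (𝓝 0)

/-- A pullback attractor: a family of nonempty compact invariant sets which
pullback attracts every bounded set and is minimal among closed pullback
attracting families. -/
def IsPullbackAttractor (U : ℝ → ℝ → X → X) (A : ℝ → Set X) : Prop :=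
  (∀ t, (A t).Nonempty) ∧ (∀ t, IsCompact (A t)) ∧
  (∀ t s : ℝ, s ≤ t → A t = U t s '' A s) ∧
  PullbackAttracts U A ∧
  (∀ C : ℝ → Set X, (∀ t, IsClosed (C t)) → PullbackAttracts U C → ∀ t, A t ⊆ C t)

/-- The family `A = {A(t)}` forward attracts every bounded set. -/
def ForwardAttracts (U : ℝ → ℝ → X → X) (A : ℝ → Set X) : Prop :=
  ∀ (t₀ : ℝ) (B : Set X), IsBounded B →
    Tendsto (fun t => esemidist (U t t₀ '' B) (A t)) atTop (𝓝 0)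

/-- A forward attractor: a family of nonempty compact invariant sets which
forward attracts every bounded set. -/
def IsForwardAttractor (U : ℝ → ℝ → X → X) (A : ℝ → Set X) : Prop :=
  (∀ t, (A t).Nonempty) ∧ (∀ t, IsCompact (A t)) ∧
  (∀ t s : ℝ, s ≤ t → A t = U t s '' A s) ∧
  ForwardAttracts U A

theorem mem_omegaF_of_tendsto_comp {U : ℝ → ℝ → X → X} {B : Set X} {t₀ : ℝ} {t : ℕ → ℝ}
    {y : ℕ → X} (ht : Tendsto t atTop atTop) (hy : ∀ n, t₀ ≤ t n ∧ y n ∈ U (t n) t₀ '' B)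
    {φ : ℕ → ℕ} (hφ : StrictMono φ) {z : X} (hz : Tendsto (y ∘ φ) atTop (𝓝 z)) :
    z ∈ omegaF U B t₀ :=
  ⟨t ∘ φ, y ∘ φ, ht.comp hφ.tendsto_atTop, fun n => hy (φ n), hz⟩

theorem FwdAsympCompact.omegaF_nonempty {U : ℝ → ℝ → X → X} (hFC : FwdAsympCompact U)
    {B : Set X} (hBne : B.Nonempty) (hB : IsBounded B) (t₀ : ℝ) :
    (omegaF U B t₀).Nonempty := by
  obtain ⟨b, hb⟩ := hBne
  have ht : Tendsto (fun n : ℕ => t₀ + n) atTop atTop :=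
    tendsto_atTop_add_const_left _ _ tendsto_natCast_atTop_atTop
  have hy : ∀ n : ℕ, t₀ ≤ t₀ + n ∧ U (t₀ + n) t₀ b ∈ U (t₀ + n) t₀ '' B :=
    fun n => ⟨by simp, mem_image_of_mem _ hb⟩
  obtain ⟨φ, z, hφ, hz⟩ := hFC t₀ B hB _ (fun n : ℕ => U (t₀ + n) t₀ b) ht hy
  exact ⟨z, mem_omegaF_of_tendsto_comp ht hy hφ hz⟩

theorem FwdAsympCompact.isCompact_omegaF {U : ℝ → ℝ → X → X} (hFC : FwdAsympCompact U)
    {B : Set X} (hB : IsBounded B) (t₀ : ℝ) : IsCompact (omegaF U B t₀) := by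
  refine IsSeqCompact.isCompact fun y hy => ?_
  have happrox : ∀ n : ℕ, ∃ (s : ℝ) (w : X), (n : ℝ) ≤ s ∧ (t₀ ≤ s ∧ w ∈ U s t₀ '' B) ∧
      dist w (y n) < 1 / ((n : ℝ) + 1) := by
    intro n
    obtain ⟨t, w, ht, hw, hlim⟩ := hy n
    obtain ⟨k, hk, hd⟩ := ((ht.eventually_ge_atTop (n : ℝ)).and
      (Metric.tendsto_nhds.1 hlim _ Nat.one_div_pos_of_nat)).exists
    exact ⟨t k, w k, hk, hw k, hd⟩
  choose s w hs hw hd using happrox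
  have hs' : Tendsto s atTop atTop := tendsto_atTop_mono hs tendsto_natCast_atTop_atTop
  obtain ⟨φ, z, hφ, hz⟩ := hFC t₀ B hB s w hs' hw
  refine ⟨z, mem_omegaF_of_tendsto_comp hs' hw hφ hz, φ, hφ, ?_⟩
  have hdist : Tendsto (fun n => dist (w n) (y n)) atTop (𝓝 0) :=
    squeeze_zero (fun _ => dist_nonneg) (fun n => (hd n).le)
      tendsto_one_div_add_atTop_nhds_zero_nat
  exact hz.congr_dist (hdist.comp hφ.tendsto_atTop)

theorem FwdAsympCompact.tendsto_esemidist_omegaF {U : ℝ → ℝ → X → X} (hFC : FwdAsympCompact U)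
    {B : Set X} (hB : IsBounded B) (t₀ : ℝ) :
    Tendsto (fun t => esemidist (U t t₀ '' B) (omegaF U B t₀)) atTop (𝓝 0) := by
  refine ENNReal.tendsto_nhds_zero.2 fun ε hε => ?_
  by_contra hev
  have hfar : ∀ n : ℕ, ∃ (s : ℝ) (w : X), (n : ℝ) ≤ s ∧ (t₀ ≤ s ∧ w ∈ U s t₀ '' B) ∧
      ε < Metric.infEDist w (omegaF U B t₀) := by
    intro n
    obtain ⟨s, hs, hns, hts⟩ := ((not_eventually.1 hev).and_eventually
      ((eventually_ge_atTop (n : ℝ)).and (eventually_ge_atTop t₀))).exists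
    obtain ⟨⟨w, hw⟩, hlt⟩ := lt_iSup_iff.1 (not_le.1 hs)
    exact ⟨s, w, hns, ⟨hts, hw⟩, hlt⟩
  choose s w hs hw hd using hfar
  have hs' : Tendsto s atTop atTop := tendsto_atTop_mono hs tendsto_natCast_atTop_atTop
  obtain ⟨φ, z, hφ, hz⟩ := hFC t₀ B hB s w hs' hw
  have hzω := mem_omegaF_of_tendsto_comp hs' hw hφ hz
  obtain ⟨n, hn⟩ := ((tendsto_iff_edist_tendsto_0.1 hz).eventually_lt_const hε).exists
  exact lt_asymm (hd (φ n)) ((Metric.infEDist_le_edist_of_mem hzω).trans_lt hn)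

/-- For a forward asymptotically compact process `U`, for every
nonempty bounded `B ⊆ X` and every `t₀ ∈ ℝ`, the forward ω-limit set
`ω_f(B,t₀)` is nonempty, compact, and forward attracts `B`. -/
theorem omegaF_nonempty_compact_attracts [CompleteSpace X]
    (U : ℝ → ℝ → X → X) (hU : IsProcess U) (hFC : FwdAsympCompact U)
    (B : Set X) (hBne : B.Nonempty) (hB : IsBounded B) (t₀ : ℝ) :
    (omegaF U B t₀).Nonempty ∧ IsCompact (omegaF U B t₀) ∧
      Tendsto (fun t => esemidist (U t t₀ '' B) (omegaF U B t₀)) atTop (𝓝 0) :=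
  ⟨hFC.omegaF_nonempty hBne hB t₀, hFC.isCompact_omegaF hB t₀,
    hFC.tendsto_esemidist_omegaF hB t₀⟩
end

section
/- Let U be a process on a complete metric space X possessing a pullback attractor A = {A(t)}, and assume U is forward asymptotically compact. If ω_f(B,t₀) ⊆ ω₀(A) for every bounded set B ⊆ X and every t₀ ∈ ℝ, then A is a forward attractor and ω(A) = ω₀(A). -/
open Filter Topology Set Metric Bornology ENNReal

variable {X : Type*} [MetricSpace X]

theorem tendsto_infEDist_of_mem_omega0Fam {K : ℝ → Set X} {z : X} (hz : z ∈ omega0Fam K)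
    {t : ℕ → ℝ} {y : ℕ → X} (ht : Tendsto t atTop atTop) (hy : Tendsto y atTop (𝓝 z)) :
    Tendsto (fun n => Metric.infEDist (y n) (K (t n))) atTop (𝓝 0) := by
  have hz' : Tendsto (fun t => Metric.infEDist z (K t)) atTop (𝓝 0) := hz
  have hsum := (hz'.comp ht).add (tendsto_iff_edist_tendsto_0.1 hy)
  rw [add_zero] at hsum
  exact tendsto_of_tendsto_of_tendsto_of_le_of_le tendsto_const_nhds hsum
    (fun _ => zero_le) (fun _ => Metric.infEDist_le_infEDist_add_edist)

theorem omega0Fam_subset_omegaFam {K : ℝ → Set X} (hne : ∀ t, (K t).Nonempty)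
    (hK : ∀ t, IsCompact (K t)) : omega0Fam K ⊆ omegaFam K := by
  intro y hy
  have hy' : Tendsto (fun t => Metric.infEDist y (K t)) atTop (𝓝 0) := hy
  choose p hpK hp using fun t => (hK t).exists_infEDist_eq_edist (hne t) y
  refine ⟨fun n => n, fun n => p n, tendsto_natCast_atTop_atTop, fun n => hpK n, ?_⟩
  rw [tendsto_iff_edist_tendsto_0]
  refine (hy'.comp tendsto_natCast_atTop_atTop).congr fun n => ?_
  rw [Function.comp_apply, hp, edist_comm]

theorem omegaFam_subset_omegaF {U : ℝ → ℝ → X → X} {K : ℝ → Set X} (t₀ : ℝ)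
    (hinv : ∀ t, t₀ ≤ t → K t = U t t₀ '' K t₀) : omegaFam K ⊆ omegaF U (K t₀) t₀ := by
  rintro y ⟨t, yn, ht, hmem, hy⟩
  obtain ⟨N, hN⟩ := eventually_atTop.1 (ht.eventually_ge_atTop t₀)
  have hshift := tendsto_add_atTop_nat N
  refine ⟨fun n => t (n + N), fun n => yn (n + N), ht.comp hshift, fun n => ?_, hy.comp hshift⟩
  have hn : t₀ ≤ t (n + N) := hN _ (Nat.le_add_left _ _)
  exact ⟨hn, hinv _ hn ▸ hmem (n + N)⟩

theorem forwardAttracts_of_omegaF_subset_omega0Fam {U : ℝ → ℝ → X → X} {K : ℝ → Set X}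
    (hFC : FwdAsympCompact U)
    (h : ∀ B : Set X, IsBounded B → ∀ t₀ : ℝ, omegaF U B t₀ ⊆ omega0Fam K) :
    ForwardAttracts U K := by
  intro t₀ B hB
  rw [ENNReal.tendsto_nhds_zero]
  intro ε hε
  by_contra hcon
  rw [eventually_atTop] at hcon
  push Not at hcon
  have hfar : ∀ n : ℕ, ∃ t : ℝ, max t₀ n ≤ t ∧
      ∃ y ∈ U t t₀ '' B, ε < Metric.infEDist y (K t) := by
    intro n
    obtain ⟨t, ht, hlt⟩ := hcon (max t₀ n)
    obtain ⟨⟨y, hy⟩, hyε⟩ := lt_iSup_iff.1 hlt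
    exact ⟨t, ht, y, hy, hyε⟩
  choose t ht y hy hyε using hfar
  have htop : Tendsto t atTop atTop :=
    tendsto_atTop_mono (fun n => (le_max_right _ _).trans (ht n)) tendsto_natCast_atTop_atTop
  have hmem : ∀ n, t₀ ≤ t n ∧ y n ∈ U (t n) t₀ '' B :=
    fun n => ⟨(le_max_left _ _).trans (ht n), hy n⟩
  obtain ⟨φ, z, hφ, hz⟩ := hFC t₀ B hB t y htop hmem
  have htφ := htop.comp hφ.tendsto_atTop
  have hzω : z ∈ omega0Fam K := h B hB t₀ ⟨t ∘ φ, y ∘ φ, htφ, fun n => hmem (φ n), hz⟩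
  have hlim := tendsto_infEDist_of_mem_omega0Fam hzω htφ hz
  obtain ⟨n, hn⟩ := (hlim.eventually_lt_const hε).exists
  exact (hyε (φ n)).not_gt hn

/-- If `U` has a pullback attractor `A`, is forward asymptotically
compact, and `ω_f(B,t₀) ⊆ ω₀(A)` for every bounded `B` and every `t₀`, then
`A` is a forward attractor and `ω(A) = ω₀(A)`. -/
theorem forwardAttractor_of_omegaF_subset_omega0 [CompleteSpace X]
    (U : ℝ → ℝ → X → X) (hU : IsProcess U)
    (A : ℝ → Set X) (hA : IsPullbackAttractor U A)
    (hFC : FwdAsympCompact U)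
    (h : ∀ B : Set X, IsBounded B → ∀ t₀ : ℝ, omegaF U B t₀ ⊆ omega0Fam A) :
    IsForwardAttractor U A ∧ omegaFam A = omega0Fam A := by
  obtain ⟨hne, hK, hinv, -, -⟩ := hA
  refine ⟨⟨hne, hK, hinv, forwardAttracts_of_omegaF_subset_omega0Fam hFC h⟩, ?_⟩
  exact ((omegaFam_subset_omegaF 0 fun t ht => hinv t 0 ht).trans
    (h (A 0) (hK 0).isBounded 0)).antisymm (omega0Fam_subset_omegaFam hne hK)
end

section
/- Let U be a process on a complete metric space X possessing a pullback attractor A = {A(t)}. If A is a forward attractor, then ω_f(B,t₀) ⊆ ω(A) for every bounded set B ⊆ X and every t₀ ∈ ℝ. -/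
open Filter Topology Set Metric Bornology ENNReal

variable {X : Type*} [MetricSpace X]

/-- If `U` has a pullback attractor `A` and `A` is a forward
attractor, then `ω_f(B,t₀) ⊆ ω(A)` for every bounded `B` and every `t₀`. -/
theorem omegaF_subset_omegaFam_of_forwardAttractor [CompleteSpace X]
    (U : ℝ → ℝ → X → X) (hU : IsProcess U)
    (A : ℝ → Set X) (hA : IsPullbackAttractor U A)
    (hFwd : IsForwardAttractor U A) :
    ∀ B : Set X, IsBounded B → ∀ t₀ : ℝ, omegaF U B t₀ ⊆ omegaFam A := by
  intro B hB t₀ y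
  rintro ⟨t, yn, ht, hyn, hy⟩
  obtain ⟨hne, hcpt, -, hattr⟩ := hFwd
  choose z hzA hz using fun n => (hcpt (t n)).exists_infEDist_eq_edist (hne (t n)) (yn n)
  refine ⟨t, z, ht, hzA, hy.congr_dist ?_⟩
  have hle : ∀ n, edist (yn n) (z n) ≤ esemidist (U (t n) t₀ '' B) (A (t n)) := fun n => by
    rw [← hz n]
    exact le_iSup (fun a : U (t n) t₀ '' B => infEDist (a : X) (A (t n))) ⟨yn n, (hyn n).2⟩
  have hlim : Tendsto (fun n => edist (yn n) (z n)) atTop (𝓝 0) :=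
    tendsto_of_tendsto_of_tendsto_of_le_of_le tendsto_const_nhds
      ((hattr t₀ B hB).comp ht) (fun _ => zero_le) hle
  simpa [Function.comp_def, edist_dist] using
    (ENNReal.tendsto_toReal ENNReal.zero_ne_top).comp hlim
end

section
/- Let U be a process on a complete metric space X possessing a pullback attractor A = {A(t)}. Assume U is forward asymptotically compact, that ω_f(B,t₀) ⊆ ω(A) for every bounded set B and every t₀ ∈ ℝ, and that dist_H(A(t), ω(A)) → 0 as t → +∞. Then A is a forward attractor. -/
open Filter Topology Set Metric Bornology ENNReal

variable {X : Type*} [MetricSpace X]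

theorem infEDist_le_esemidist {A : Set X} {a : X} (ha : a ∈ A) (B : Set X) :
    infEDist a B ≤ esemidist A B :=
  le_iSup (fun a : A => infEDist (a : X) B) ⟨a, ha⟩

/-- If the family `K` is close to a set `C` containing all forward ω-limit points of a
bounded set `B`, then `K` forward attracts `B`. -/
theorem FwdAsympCompact.tendsto_esemidist {U : ℝ → ℝ → X → X} (hU : FwdAsympCompact U)
    {B : Set X} (hB : IsBounded B) {t₀ : ℝ} {K : ℝ → Set X} {C : Set X}
    (hC : omegaF U B t₀ ⊆ C) (hK : Tendsto (fun t => esemidist C (K t)) atTop (𝓝 0)) :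
    Tendsto (fun t => esemidist (U t t₀ '' B) (K t)) atTop (𝓝 0) := by
  rw [ENNReal.tendsto_nhds_zero]
  by_contra! h
  obtain ⟨ε, hε, hfreq⟩ := h
  have hfar : ∃ᶠ t in atTop, t₀ ≤ t ∧ ∃ y ∈ U t t₀ '' B, ε < infEDist y (K t) := by
    refine (hfreq.and_eventually (eventually_ge_atTop t₀)).mono fun t ⟨ht, hle⟩ => ⟨hle, ?_⟩
    obtain ⟨⟨y, hy⟩, hlt⟩ := lt_iSup_iff.1 ht
    exact ⟨y, hy, hlt⟩
  obtain ⟨t, ht, hfar⟩ := exists_seq_forall_of_frequently hfar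
  choose hle y hy hlt using hfar
  obtain ⟨φ, z, hφ, hz⟩ := hU t₀ B hB t y ht fun n => ⟨hle n, hy n⟩
  have htφ := ht.comp hφ.tendsto_atTop
  have hzC : z ∈ C := hC ⟨t ∘ φ, y ∘ φ, htφ, fun n => ⟨hle _, hy _⟩, hz⟩
  have hsum : Tendsto (fun n => esemidist C (K (t (φ n))) + edist (y (φ n)) z) atTop (𝓝 0) := by
    simpa using (hK.comp htφ).add (tendsto_iff_edist_tendsto_0.1 hz)
  obtain ⟨n, hn⟩ := (hsum.eventually_lt_const hε).exists
  have hbound : infEDist (y (φ n)) (K (t (φ n))) ≤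
      esemidist C (K (t (φ n))) + edist (y (φ n)) z :=
    infEDist_le_infEDist_add_edist.trans (add_le_add_left (infEDist_le_esemidist hzC _) _)
  exact absurd (hlt (φ n)) (not_lt.2 (hbound.trans hn.le))

/-- If `U` has a pullback attractor `A`, is forward asymptotically
compact, `ω_f(B,t₀) ⊆ ω(A)` for every bounded `B` and every `t₀`, and
`dist_H(A(t), ω(A)) → 0` as `t → +∞`, then `A` is a forward attractor. -/
theorem forwardAttractor_of_omega_conditions [CompleteSpace X]
    (U : ℝ → ℝ → X → X) (hU : IsProcess U)
    (A : ℝ → Set X) (hA : IsPullbackAttractor U A)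
    (hFC : FwdAsympCompact U)
    (hω : ∀ B : Set X, IsBounded B → ∀ t₀ : ℝ, omegaF U B t₀ ⊆ omegaFam A)
    (hH : Tendsto (fun t => ehdist (A t) (omegaFam A)) atTop (𝓝 0)) :
    IsForwardAttractor U A := by
  obtain ⟨hne, hcpt, hinv, -, -⟩ := hA
  refine ⟨hne, hcpt, hinv, fun t₀ B hB => hFC.tendsto_esemidist hB (hω B hB t₀) ?_⟩
  exact tendsto_of_tendsto_of_tendsto_of_le_of_le tendsto_const_nhds hH
    (fun _ => zero_le) fun _ => le_max_right _ _
end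

section
/- Let U be a process on a complete metric space X possessing a pullback attractor A = {A(t)}, and let S be a semigroup on X possessing a global attractor A_∞. If U is asymptotically autonomous with limit semigroup S and forward asymptotically compact, then dist(A(t), A_∞) → 0 as t → +∞. -/
open Filter Topology Set Metric Bornology ENNReal

variable {X : Type*} [MetricSpace X]

/-- A continuous semigroup on `X` (defined for nonnegative times). -/
def IsSemigroupFlow (S : ℝ → X → X) : Prop :=
  (∀ x : X, S 0 x = x) ∧
  (∀ (t s : ℝ) (x : X), 0 ≤ t → 0 ≤ s → S (t + s) x = S t (S s x)) ∧
  ContinuousOn (fun p : ℝ × X => S p.1 p.2) {p : ℝ × X | 0 ≤ p.1}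

/-- A global attractor for a semigroup `S`: a compact invariant set attracting
every bounded set. -/
def IsGlobalAttractor (S : ℝ → X → X) (Ainf : Set X) : Prop :=
  IsCompact Ainf ∧ (∀ t : ℝ, 0 ≤ t → S t '' Ainf = Ainf) ∧
  ∀ B : Set X, IsBounded B →
    Tendsto (fun t => esemidist (S t '' B) Ainf) atTop (𝓝 0)

/-- The process `U` is asymptotically autonomous with limit semigroup `S`:
for all sequences `τ_n → +∞` and `x_n → x₀` one has
`U(t + τ_n, τ_n, x_n) → S(t, x₀)` for every `t ≥ 0`. -/
def AsympAutonomous (U : ℝ → ℝ → X → X) (S : ℝ → X → X) : Prop :=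
  ∀ (τ : ℕ → ℝ) (x : ℕ → X) (x₀ : X), Tendsto τ atTop atTop →
    Tendsto x atTop (𝓝 x₀) → ∀ t : ℝ, 0 ≤ t →
      Tendsto (fun n => U (t + τ n) (τ n) (x n)) atTop (𝓝 (S t x₀))

/-- Along times tending to `+∞`, points of an invariant family with bounded sections accumulate
at its ω-limit set, provided the process is forward asymptotically compact. -/
theorem exists_subseq_tendsto_omegaFam {U : ℝ → ℝ → X → X} {A : ℝ → Set X}
    (hFC : FwdAsympCompact U) {t₀ : ℝ} (hb : IsBounded (A t₀))
    (hinv : ∀ t, t₀ ≤ t → A t = U t t₀ '' A t₀)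
    {t : ℕ → ℝ} {y : ℕ → X} (ht : Tendsto t atTop atTop) (hy : ∀ n, y n ∈ A (t n)) :
    ∃ (φ : ℕ → ℕ) (z : X), StrictMono φ ∧ Tendsto (y ∘ φ) atTop (𝓝 z) ∧ z ∈ omegaFam A := by
  obtain ⟨N, hN⟩ := eventually_atTop.1 (ht.eventually_ge_atTop t₀)
  obtain ⟨φ, z, hφ, hz⟩ := hFC t₀ (A t₀) hb (fun n => t (n + N)) (fun n => y (n + N))
    (ht.comp (tendsto_add_atTop_nat N)) fun n =>
      ⟨hN _ (Nat.le_add_left N n), hinv _ (hN _ (Nat.le_add_left N n)) ▸ hy (n + N)⟩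
  have hφN : StrictMono fun n => φ n + N := fun a b hab => Nat.add_lt_add_right (hφ hab) N
  exact ⟨fun n => φ n + N, z, hφN, hz, fun n => t (φ n + N), fun n => y (φ n + N),
    ht.comp hφN.tendsto_atTop, fun n => hy _, hz⟩

/-- The ω-limit set of a family is bounded if points of the family along times tending to `+∞`
have convergent subsequences. -/
theorem isBounded_omegaFam {A : ℝ → Set X}
    (hsub : ∀ (t : ℕ → ℝ) (y : ℕ → X), Tendsto t atTop atTop → (∀ n, y n ∈ A (t n)) →
      ∃ (φ : ℕ → ℕ) (z : X), StrictMono φ ∧ Tendsto (y ∘ φ) atTop (𝓝 z)) :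
    IsBounded (omegaFam A) := by
  by_contra hunb
  have hne : (omegaFam A).Nonempty := by
    by_contra h
    exact hunb (not_nonempty_iff_eq_empty.1 h ▸ isBounded_empty)
  obtain ⟨x₀, -⟩ := hne
  have key : ∀ n : ℕ, ∃ (s : ℝ) (y : X), (n : ℝ) ≤ s ∧ y ∈ A s ∧ (n : ℝ) < dist y x₀ := by
    intro n
    obtain ⟨z, ⟨s, y, hs, hy, hyz⟩, hz⟩ : ∃ z ∈ omegaFam A, (n : ℝ) < dist z x₀ := by
      by_contra! h
      exact hunb (isBounded_closedBall.subset fun z hz => mem_closedBall.2 (h z hz))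
    obtain ⟨k, hk, hk'⟩ := ((hs.eventually_ge_atTop (n : ℝ)).and
      ((hyz.dist tendsto_const_nhds).eventually_const_lt hz)).exists
    exact ⟨s k, y k, hk, hy k, hk'⟩
  choose s y hs hy hd using key
  obtain ⟨φ, z, hφ, hz⟩ := hsub s y (tendsto_atTop_mono hs tendsto_natCast_atTop_atTop) hy
  exact not_tendsto_nhds_of_tendsto_atTop
    (tendsto_atTop_mono (fun n => (hd (φ n)).le)
      (tendsto_natCast_atTop_atTop.comp hφ.tendsto_atTop)) _ (hz.dist tendsto_const_nhds)

/-- The ω-limit set of an invariant family of an asymptotically autonomous process is negatively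
invariant under the limit semigroup. -/
theorem omegaFam_subset_image {U : ℝ → ℝ → X → X} {S : ℝ → X → X} {A : ℝ → Set X}
    (hinv : ∀ t s : ℝ, s ≤ t → A t = U t s '' A s) (hAA : AsympAutonomous U S)
    (hFC : FwdAsympCompact U) {t₀ : ℝ} (hb : IsBounded (A t₀)) {t : ℝ} (ht : 0 ≤ t) :
    omegaFam A ⊆ S t '' omegaFam A := by
  rintro z ⟨s, y, hs, hy, hyz⟩
  have hpre : ∀ n, ∃ x ∈ A (s n - t), U (s n) (s n - t) x = y n := fun n => by
    have h := hy n
    rwa [hinv (s n) (s n - t) (sub_le_self _ ht)] at h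
  choose x hx hxy using hpre
  have hst : Tendsto (fun n => s n - t) atTop atTop := tendsto_atTop_add_const_right _ (-t) hs
  obtain ⟨φ, w, hφ, hw, hwΩ⟩ :=
    exists_subseq_tendsto_omegaFam hFC hb (fun r hr => hinv r t₀ hr) hst hx
  refine ⟨w, hwΩ, tendsto_nhds_unique
    (hAA (fun n => s (φ n) - t) (x ∘ φ) w (hst.comp hφ.tendsto_atTop) hw t ht) ?_⟩
  have heq : (fun n => U (t + (s (φ n) - t)) (s (φ n) - t) ((x ∘ φ) n)) = y ∘ φ := by
    funext n
    simp [hxy]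
  rw [heq]
  exact hyz.comp hφ.tendsto_atTop

/-- If `U` has a pullback attractor `A`, `S` has a global
attractor `A_∞`, and `U` is asymptotically autonomous with limit semigroup `S`
and forward asymptotically compact, then `dist(A(t), A_∞) → 0` as `t → +∞`. -/
theorem attractor_upper_semicontinuity [CompleteSpace X]
    (U : ℝ → ℝ → X → X) (hU : IsProcess U)
    (A : ℝ → Set X) (hA : IsPullbackAttractor U A)
    (S : ℝ → X → X) (hS : IsSemigroupFlow S)
    (Ainf : Set X) (hAinf : IsGlobalAttractor S Ainf)
    (hAA : AsympAutonomous U S) (hFC : FwdAsympCompact U) :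
    Tendsto (fun t => esemidist (A t) Ainf) atTop (𝓝 0) := by
  obtain ⟨-, hcpt, hinv, -, -⟩ := hA
  have hb : IsBounded (A 0) := (hcpt 0).isBounded
  have hsub {t : ℕ → ℝ} {y : ℕ → X} (ht : Tendsto t atTop atTop) (hy : ∀ n, y n ∈ A (t n)) :=
    exists_subseq_tendsto_omegaFam hFC hb (fun r hr => hinv r 0 hr) ht hy
  have hΩb : IsBounded (omegaFam A) := isBounded_omegaFam fun t y ht hy =>
    let ⟨φ, z, hφ, hz, _⟩ := hsub ht hy
    ⟨φ, z, hφ, hz⟩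
  have hΩ : ∀ z ∈ omegaFam A, Metric.infEDist z Ainf = 0 := fun z hz =>
    le_antisymm (ge_of_tendsto (hAinf.2.2 _ hΩb) ((eventually_ge_atTop 0).mono fun t ht =>
      le_iSup (fun a : S t '' omegaFam A => Metric.infEDist (a : X) Ainf)
        ⟨z, omegaFam_subset_image hinv hAA hFC hb ht hz⟩)) zero_le
  rw [ENNReal.tendsto_nhds_zero]
  intro ε hε
  by_contra hcon
  have key : ∀ n : ℕ, ∃ (s : ℝ) (y : X), (n : ℝ) ≤ s ∧ y ∈ A s ∧ ε < Metric.infEDist y Ainf := by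
    intro n
    obtain ⟨s, hs, hsε⟩ := frequently_atTop.1 (not_eventually.1 hcon) (n : ℝ)
    obtain ⟨a, ha⟩ := lt_iSup_iff.1 (not_le.1 hsε)
    exact ⟨s, a, hs, a.2, ha⟩
  choose s y hs hy hd using key
  obtain ⟨φ, z, -, hz, hzΩ⟩ := hsub (tendsto_atTop_mono hs tendsto_natCast_atTop_atTop) hy
  have hle : ε ≤ Metric.infEDist z Ainf :=
    ge_of_tendsto' ((Metric.continuous_infEDist.tendsto z).comp hz) fun n => (hd (φ n)).le
  exact hε.not_ge (hle.trans_eq (hΩ z hzΩ))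
end

section
/- Let U be a multivalued process on a complete metric space X. If A₁ = {A₁(t)} and A₂ = {A₂(t)} are two forward attractors for U, then they are asymptotically equivalent: dist_H(A₁(t), A₂(t)) → 0 as t → +∞. -/
open Filter Topology Set Metric Bornology ENNReal

variable {X : Type*} [MetricSpace X]

/-- Image of a set `B` under a multivalued map `U(t,s,·)`. -/
def MImage (U : ℝ → ℝ → X → Set X) (t s : ℝ) (B : Set X) : Set X :=
  ⋃ x ∈ B, U t s x

/-- A multivalued process on `X`: `U(s,s,x) = {x}`, each value is nonempty and
`U(t,s,x) ⊆ U(t,τ,U(τ,s,x))` for `s ≤ τ ≤ t`. -/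
def IsMultiProcess (U : ℝ → ℝ → X → Set X) : Prop :=
  (∀ (s : ℝ) (x : X), U s s x = {x}) ∧
  (∀ (t s : ℝ) (x : X), s ≤ t → (U t s x).Nonempty) ∧
  (∀ (t τ s : ℝ) (x : X), s ≤ τ → τ ≤ t → U t s x ⊆ MImage U t τ (U τ s x))

/-- The multivalued process `U` is forward asymptotically compact. -/
def MFwdAsympCompact (U : ℝ → ℝ → X → Set X) : Prop :=
  ∀ (t₀ : ℝ) (B : Set X), IsBounded B →
    ∀ (t : ℕ → ℝ) (y : ℕ → X), Tendsto t atTop atTop →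
      (∀ n, t₀ ≤ t n ∧ y n ∈ MImage U (t n) t₀ B) →
      ∃ (φ : ℕ → ℕ) (z : X), StrictMono φ ∧ Tendsto (y ∘ φ) atTop (𝓝 z)

/-- Forward ω-limit set `ω_f(B,t₀)` of a set `B` for initial time `t₀`. -/
def MomegaF (U : ℝ → ℝ → X → Set X) (B : Set X) (t₀ : ℝ) : Set X :=
  {y | ∃ (t : ℕ → ℝ) (yn : ℕ → X), Tendsto t atTop atTop ∧
        (∀ n, t₀ ≤ t n ∧ yn n ∈ MImage U (t n) t₀ B) ∧ Tendsto yn atTop (𝓝 y)}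

/-- The family `C = {C(t)}` pullback attracts every bounded set. -/
def MPullbackAttracts (U : ℝ → ℝ → X → Set X) (C : ℝ → Set X) : Prop :=
  ∀ (t : ℝ) (B : Set X), IsBounded B →
    Tendsto (fun t₀ => esemidist (MImage U t t₀ B) (C t)) atBot (𝓝 0)

/-- A pullback attractor for a multivalued process: a family of nonempty compact
negatively invariant sets which pullback attracts every bounded set and is
minimal among closed pullback attracting families. -/
def MIsPullbackAttractor (U : ℝ → ℝ → X → Set X) (A : ℝ → Set X) : Prop :=
  (∀ t, (A t).Nonempty) ∧ (∀ t, IsCompact (A t)) ∧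
  (∀ t s : ℝ, s ≤ t → A t ⊆ MImage U t s (A s)) ∧
  MPullbackAttracts U A ∧
  (∀ C : ℝ → Set X, (∀ t, IsClosed (C t)) → MPullbackAttracts U C → ∀ t, A t ⊆ C t)

/-- The family `A = {A(t)}` forward attracts every bounded set. -/
def MForwardAttracts (U : ℝ → ℝ → X → Set X) (A : ℝ → Set X) : Prop :=
  ∀ (t₀ : ℝ) (B : Set X), IsBounded B →
    Tendsto (fun t => esemidist (MImage U t t₀ B) (A t)) atTop (𝓝 0)

/-- A forward attractor for a multivalued process: a family of nonempty compact
negatively invariant sets which forward attracts every bounded set. -/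
def MIsForwardAttractor (U : ℝ → ℝ → X → Set X) (A : ℝ → Set X) : Prop :=
  (∀ t, (A t).Nonempty) ∧ (∀ t, IsCompact (A t)) ∧
  (∀ t s : ℝ, s ≤ t → A t ⊆ MImage U t s (A s)) ∧
  MForwardAttracts U A

theorem MIsForwardAttractor.tendsto_esemidist {U : ℝ → ℝ → X → Set X} {A₁ A₂ : ℝ → Set X}
    (h₁ : MIsForwardAttractor U A₁) (h₂ : MForwardAttracts U A₂) :
    Tendsto (fun t => esemidist (A₁ t) (A₂ t)) atTop (𝓝 0) := by
  obtain ⟨-, hcompact, hinv, -⟩ := h₁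
  refine tendsto_of_tendsto_of_tendsto_of_le_of_le' tendsto_const_nhds
    (h₂ 0 (A₁ 0) (hcompact 0).isBounded) (Eventually.of_forall fun _ => zero_le) ?_
  filter_upwards [eventually_ge_atTop 0] with t ht
  exact iSup_le fun a =>
    le_iSup (fun b : MImage U t 0 (A₁ 0) => Metric.infEDist (b : X) (A₂ t)) ⟨a, hinv t 0 ht a.2⟩

/-- Two forward attractors of a multivalued process are
asymptotically equivalent: `dist_H(A₁(t), A₂(t)) → 0` as `t → +∞`. -/
theorem forwardAttractors_asympEquivalent [CompleteSpace X]
    (U : ℝ → ℝ → X → Set X) (hU : IsMultiProcess U)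
    (A₁ A₂ : ℝ → Set X)
    (h₁ : MIsForwardAttractor U A₁) (h₂ : MIsForwardAttractor U A₂) :
    Tendsto (fun t => ehdist (A₁ t) (A₂ t)) atTop (𝓝 0) := by
  simpa [ehdist] using (h₁.tendsto_esemidist h₂.2.2.2).max (h₂.tendsto_esemidist h₁.2.2.2)
end

section
/- Let X be a complete metric space and K = {K(t)}_{t∈ℝ} a family of nonempty subsets of X that is forward asymptotically compact. Then the set ω(K) is nonempty, compact, and forward attracts K, i.e. dist(K(t), ω(K)) → 0 as t → +∞. -/
open Filter Topology Set Metric Bornology ENNReal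

variable {X : Type*} [MetricSpace X]

/-- A family `K = {K(t)}` is forward asymptotically compact if every sequence
`y_n ∈ K(t_n)` with `t_n → +∞` has a convergent subsequence. -/
def FamFwdAsympCompact (K : ℝ → Set X) : Prop :=
  ∀ (t : ℕ → ℝ) (y : ℕ → X), Tendsto t atTop atTop → (∀ n, y n ∈ K (t n)) →
    ∃ (φ : ℕ → ℕ) (z : X), StrictMono φ ∧ Tendsto (y ∘ φ) atTop (𝓝 z)

/-- Every limit of a subsequence of `y n ∈ K (t n)`, `t n → +∞`, belongs to `ω(K)`. -/
theorem mem_omegaFam_of_subseq {K : ℝ → Set X} {t : ℕ → ℝ} {y : ℕ → X} {φ : ℕ → ℕ} {z : X}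
    (ht : Tendsto t atTop atTop) (hy : ∀ n, y n ∈ K (t n)) (hφ : StrictMono φ)
    (hz : Tendsto (y ∘ φ) atTop (𝓝 z)) : z ∈ omegaFam K :=
  ⟨t ∘ φ, y ∘ φ, ht.comp hφ.tendsto_atTop, fun n => hy (φ n), hz⟩

/-- Points of `ω(K)` are approximated by points of `K s` with `s` arbitrarily large. -/
theorem exists_dist_lt_of_mem_omegaFam {K : ℝ → Set X} {x : X} (hx : x ∈ omegaFam K)
    (T : ℝ) {ε : ℝ} (hε : 0 < ε) : ∃ s, T ≤ s ∧ ∃ y ∈ K s, dist x y < ε := by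
  obtain ⟨t, y, ht, hy, hyx⟩ := hx
  obtain ⟨n, hn, hd⟩ :=
    ((ht.eventually_ge_atTop T).and (hyx.eventually (Metric.ball_mem_nhds x hε))).exists
  exact ⟨t n, hn, y n, hy n, by rwa [dist_comm]⟩

theorem FamFwdAsympCompact.omegaFam_nonempty {K : ℝ → Set X} (hFC : FamFwdAsympCompact K)
    (hK : ∀ t, (K t).Nonempty) : (omegaFam K).Nonempty := by
  choose y hy using fun n : ℕ => hK n
  obtain ⟨φ, z, hφ, hz⟩ := hFC _ y tendsto_natCast_atTop_atTop hy
  exact ⟨z, mem_omegaFam_of_subseq tendsto_natCast_atTop_atTop hy hφ hz⟩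

theorem FamFwdAsympCompact.isCompact_omegaFam {K : ℝ → Set X} (hFC : FamFwdAsympCompact K) :
    IsCompact (omegaFam K) := by
  refine IsSeqCompact.isCompact fun x hx => ?_
  choose t ht y hy hd using fun n : ℕ =>
    exists_dist_lt_of_mem_omegaFam (hx n) n (Nat.one_div_pos_of_nat (α := ℝ) (n := n))
  have ht' : Tendsto t atTop atTop := tendsto_atTop_mono ht tendsto_natCast_atTop_atTop
  obtain ⟨φ, z, hφ, hz⟩ := hFC t y ht' hy
  have hxy : Tendsto (fun n => dist (y n) (x n)) atTop (𝓝 0) :=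
    squeeze_zero (fun _ => dist_nonneg) (fun n => by rw [dist_comm]; exact (hd n).le)
      tendsto_one_div_add_atTop_nhds_zero_nat
  exact ⟨z, mem_omegaFam_of_subseq ht' hy hφ hz, φ, hφ,
    hz.congr_dist (hxy.comp hφ.tendsto_atTop)⟩

theorem FamFwdAsympCompact.tendsto_esemidist_omegaFam {K : ℝ → Set X}
    (hFC : FamFwdAsympCompact K) :
    Tendsto (fun t => esemidist (K t) (omegaFam K)) atTop (𝓝 0) := by
  rw [ENNReal.tendsto_nhds_zero]
  intro ε hε
  by_contra hfreq
  have hfar : ∀ n : ℕ, ∃ t : ℝ, n ≤ t ∧ ∃ y ∈ K t, ε < Metric.infEDist y (omegaFam K) := by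
    intro n
    obtain ⟨t, hnt, ht⟩ := (frequently_atTop.mp (not_eventually.mp hfreq)) n
    obtain ⟨y, hy⟩ := lt_iSup_iff.mp (not_le.mp ht)
    exact ⟨t, hnt, y, y.2, hy⟩
  choose t ht y hy hd using hfar
  have ht' : Tendsto t atTop atTop := tendsto_atTop_mono ht tendsto_natCast_atTop_atTop
  obtain ⟨φ, z, hφ, hz⟩ := hFC t y ht' hy
  have hzω := mem_omegaFam_of_subseq ht' hy hφ hz
  obtain ⟨n, hn⟩ := (hz.eventually (Metric.eball_mem_nhds z hε)).exists
  exact lt_asymm (hd (φ n)) ((Metric.infEDist_le_edist_of_mem hzω).trans_lt hn)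

/-- If a family `K = {K(t)}` of nonempty sets is forward
asymptotically compact, then `ω(K)` is nonempty, compact and forward attracts
`K`, i.e. `dist(K(t), ω(K)) → 0` as `t → +∞`. -/
theorem omegaFam_nonempty_compact_attracts [CompleteSpace X]
    (K : ℝ → Set X) (hK : ∀ t, (K t).Nonempty)
    (hFC : FamFwdAsympCompact K) :
    (omegaFam K).Nonempty ∧ IsCompact (omegaFam K) ∧
      Tendsto (fun t => esemidist (K t) (omegaFam K)) atTop (𝓝 0) := by
  exact ⟨hFC.omegaFam_nonempty hK, hFC.isCompact_omegaFam, hFC.tendsto_esemidist_omegaFam⟩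
end

section
/- Let U be a multivalued process on a complete metric space X possessing a pullback attractor A = {A(t)}. If A is a forward attractor, then ω_f(B,t₀) ⊆ ω(A) for every bounded set B ⊆ X and every t₀ ∈ ℝ. -/
open Filter Topology Set Metric Bornology ENNReal

variable {X : Type*} [MetricSpace X]

/-- If the multivalued process `U` has a pullback attractor `A`
and `A` is a forward attractor, then `ω_f(B,t₀) ⊆ ω(A)` for every bounded `B`
and every `t₀`. -/
theorem mOmegaF_subset_omegaFam_of_forwardAttractor [CompleteSpace X]
    (U : ℝ → ℝ → X → Set X) (hU : IsMultiProcess U)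
    (A : ℝ → Set X) (hA : MIsPullbackAttractor U A)
    (hFwd : MIsForwardAttractor U A) :
    ∀ B : Set X, IsBounded B → ∀ t₀ : ℝ, MomegaF U B t₀ ⊆ omegaFam A := by
  rintro B hB t₀ y ⟨t, yn, ht, hyn, hy⟩
  obtain ⟨hne, hcomp, -, hattr⟩ := hFwd
  have hdist : Tendsto (fun n => Metric.infEDist (yn n) (A (t n))) atTop (𝓝 0) :=
    tendsto_of_tendsto_of_tendsto_of_le_of_le tendsto_const_nhds ((hattr t₀ B hB).comp ht)
      (fun _ => zero_le) fun n =>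
        le_iSup (fun a : MImage U (t n) t₀ B => Metric.infEDist (a : X) (A (t n)))
          ⟨yn n, (hyn n).2⟩
  choose z hzA hz using fun n => (hcomp (t n)).exists_infEDist_eq_edist (hne (t n)) (yn n)
  refine ⟨t, z, ht, hzA, ?_⟩
  refine (tendsto_iff_of_dist ?_).1 hy
  have hed : Tendsto (fun n => edist (yn n) (z n)) atTop (𝓝 0) := hdist.congr hz
  simpa [Function.comp_def, edist_dist, dist_nonneg] using (ENNReal.tendsto_toReal ENNReal.zero_ne_top).comp hed
end

section
/- Let U be a multivalued process on a complete metric space X possessing a pullback attractor A = {A(t)}. Assume U is forward asymptotically compact, that ω_f(B,t₀) ⊆ ω(A) for every bounded set B and every t₀ ∈ ℝ, and that dist_H(A(t), ω(A)) → 0 as t → +∞. Then A is a forward attractor. -/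
open Filter Topology Set Metric Bornology ENNReal

variable {X : Type*} [MetricSpace X]

/-- If the multivalued process `U` has a pullback attractor `A`,
is forward asymptotically compact, `ω_f(B,t₀) ⊆ ω(A)` for every bounded `B`
and every `t₀`, and `dist_H(A(t), ω(A)) → 0` as `t → +∞`, then `A` is a
forward attractor. -/
theorem mForwardAttractor_of_omega_conditions [CompleteSpace X]
    (U : ℝ → ℝ → X → Set X) (hU : IsMultiProcess U)
    (A : ℝ → Set X) (hA : MIsPullbackAttractor U A)
    (hFC : MFwdAsympCompact U)
    (hω : ∀ B : Set X, IsBounded B → ∀ t₀ : ℝ, MomegaF U B t₀ ⊆ omegaFam A)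
    (hH : Tendsto (fun t => ehdist (A t) (omegaFam A)) atTop (𝓝 0)) :
    MIsForwardAttractor U A := by
  obtain ⟨hne, hcomp, hinv, -, -⟩ := hA
  refine ⟨hne, hcomp, hinv, fun t₀ B hB => ?_⟩
  rw [ENNReal.tendsto_nhds_zero]
  by_contra! hcon
  obtain ⟨ε, hε, hnot⟩ := hcon
  have hfreq : ∃ᶠ t in atTop, ε < esemidist (MImage U t t₀ B) (A t) := by
    simpa [Filter.Frequently, not_lt] using hnot
  have hseq : ∀ n : ℕ, ∃ t : ℝ, ∃ y : X, max (n : ℝ) t₀ ≤ t ∧ y ∈ MImage U t t₀ B ∧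
      ε < Metric.infEDist y (A t) := by
    intro n
    obtain ⟨t, hlt, hge⟩ := (hfreq.and_eventually (eventually_ge_atTop (max (n : ℝ) t₀))).exists
    obtain ⟨⟨y, hy⟩, hεy⟩ := lt_iSup_iff.mp hlt
    exact ⟨t, y, hge, hy, hεy⟩
  choose t y ht hy hεy using hseq
  have htop : Tendsto t atTop atTop :=
    tendsto_atTop_mono (fun n => (le_max_left _ _).trans (ht n)) tendsto_natCast_atTop_atTop
  have hmem : ∀ n, t₀ ≤ t n ∧ y n ∈ MImage U (t n) t₀ B :=
    fun n => ⟨(le_max_right _ _).trans (ht n), hy n⟩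
  obtain ⟨φ, z, hφ, hz⟩ := hFC t₀ B hB t y htop hmem
  have htφ : Tendsto (t ∘ φ) atTop atTop := htop.comp hφ.tendsto_atTop
  have hzω : z ∈ omegaFam A := hω B hB t₀ ⟨t ∘ φ, y ∘ φ, htφ, fun n => hmem (φ n), hz⟩
  have hlim : Tendsto (fun n => ehdist (A (t (φ n))) (omegaFam A) + edist (y (φ n)) z)
      atTop (𝓝 0) := by
    simpa using (hH.comp htφ).add (tendsto_iff_edist_tendsto_0.mp hz)
  obtain ⟨n, hn⟩ := (hlim.eventually_lt_const hε).exists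
  refine (hεy (φ n)).not_ge (le_trans ?_ hn.le)
  refine Metric.infEDist_le_infEDist_add_edist.trans (add_le_add_left ?_ _)
  exact (le_iSup (fun a : omegaFam A => Metric.infEDist (a : X) (A (t (φ n)))) ⟨z, hzω⟩).trans
    (le_max_right _ _)
end

section
/- Let U be a multivalued process on a complete metric space X possessing a pullback attractor A = {A(t)}, and assume U is forward asymptotically compact. Then the condition 'ω_f(B,t₀) ⊆ ω₀(A) for every bounded set B and every t₀ ∈ ℝ' holds if and only if dist(A_min, A(t)) → 0 as t → +∞. -/
open Filter Topology Set Metric Bornology ENNReal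

variable {X : Type*} [MetricSpace X]

/-- The minimal forward attracting set
`A_min = closure (⋃_{B bounded} ⋃_{t₀ ∈ ℝ} ω_f(B,t₀))`. -/
def MAmin (U : ℝ → ℝ → X → Set X) : Set X :=
  closure (⋃ (B : Set X) (_ : IsBounded B) (t₀ : ℝ), MomegaF U B t₀)

theorem isClosed_omega0Fam (K : ℝ → Set X) : IsClosed (omega0Fam K) := by
  refine isClosed_of_closure_subset fun y hy => ?_
  refine ENNReal.tendsto_nhds_zero.2 fun ε hε => ?_
  obtain ⟨z, hz, hyz⟩ := EMetric.mem_closure_iff.1 hy (ε / 2) (ENNReal.half_pos hε.ne')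
  filter_upwards [ENNReal.tendsto_nhds_zero.1 hz (ε / 2) (ENNReal.half_pos hε.ne')] with t ht
  calc Metric.infEDist y (K t) ≤ Metric.infEDist z (K t) + edist y z :=
        Metric.infEDist_le_infEDist_add_edist
    _ ≤ ε / 2 + ε / 2 := add_le_add ht hyz.le
    _ = ε := ENNReal.add_halves ε

/-- If `A` is negatively invariant with bounded `A 0` and `U` is forward asymptotically compact,
then every sequence in `ω₀(A)` has a convergent subsequence. -/
theorem exists_tendsto_subseq_of_mem_omega0Fam {U : ℝ → ℝ → X → Set X} {A : ℝ → Set X}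
    (hb : IsBounded (A 0)) (hinv : ∀ t s : ℝ, s ≤ t → A t ⊆ MImage U t s (A s))
    (hFC : MFwdAsympCompact U) {y : ℕ → X} (hy : ∀ n, y n ∈ omega0Fam A) :
    ∃ (φ : ℕ → ℕ) (z : X), StrictMono φ ∧ Tendsto (y ∘ φ) atTop (𝓝 z) := by
  have hpos (n : ℕ) : (0 : ℝ≥0∞) < ((n : ℝ≥0∞) + 1)⁻¹ :=
    ENNReal.inv_pos.2 (ENNReal.add_ne_top.2 ⟨ENNReal.natCast_ne_top n, ENNReal.one_ne_top⟩)
  have hchoose (n : ℕ) : ∃ (s : ℝ) (w : X), (n : ℝ) ≤ s ∧ w ∈ A s ∧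
      edist (y n) w < ((n : ℝ≥0∞) + 1)⁻¹ := by
    obtain ⟨s, hs, hns⟩ :=
      (((hy n).eventually (gt_mem_nhds (hpos n))).and (eventually_ge_atTop (n : ℝ))).exists
    obtain ⟨w, hw, hyw⟩ := Metric.infEDist_lt_iff.1 hs
    exact ⟨s, w, hns, hw, hyw⟩
  choose s w hs hw hyw using hchoose
  have hs0 (n : ℕ) : 0 ≤ s n := n.cast_nonneg.trans (hs n)
  obtain ⟨φ, z, hφ, hz⟩ := hFC 0 (A 0) hb s w
    (tendsto_atTop_mono hs tendsto_natCast_atTop_atTop)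
    fun n => ⟨hs0 n, hinv _ _ (hs0 n) (hw n)⟩
  have hinv0 : Tendsto (fun n : ℕ => ((n : ℝ≥0∞) + 1)⁻¹) atTop (𝓝 0) := by
    simpa using (tendsto_add_atTop_iff_nat 1).2 ENNReal.tendsto_inv_nat_nhds_zero
  have hd : Tendsto (fun n => edist (y n) (w n)) atTop (𝓝 0) :=
    tendsto_of_tendsto_of_tendsto_of_le_of_le tendsto_const_nhds hinv0
      (fun _ => zero_le) fun n => (hyw n).le
  refine ⟨φ, z, hφ, tendsto_iff_edist_tendsto_0.2 ?_⟩
  refine tendsto_of_tendsto_of_tendsto_of_le_of_le tendsto_const_nhds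
    (by simpa using (hd.comp hφ.tendsto_atTop).add (tendsto_iff_edist_tendsto_0.1 hz))
    (fun _ => zero_le) fun n => edist_triangle (y (φ n)) (w (φ n)) z

/-- A subset of `ω₀(K)` that is relatively sequentially compact is attracted by `K` uniformly. -/
theorem tendsto_esemidist_of_subset_omega0Fam {K : ℝ → Set X} {S : Set X}
    (hS : S ⊆ omega0Fam K)
    (hcomp : ∀ y : ℕ → X, (∀ n, y n ∈ S) →
      ∃ (φ : ℕ → ℕ) (z : X), StrictMono φ ∧ Tendsto (y ∘ φ) atTop (𝓝 z)) :
    Tendsto (fun t => esemidist S (K t)) atTop (𝓝 0) := by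
  refine ENNReal.tendsto_nhds_zero.2 fun ε hε => ?_
  by_contra hcon
  have hbad (n : ℕ) : ∃ (t : ℝ) (y : X), (n : ℝ) ≤ t ∧ y ∈ S ∧ ε < Metric.infEDist y (K t) := by
    obtain ⟨t, ht, hnt⟩ := ((not_eventually.1 hcon).and_eventually
      (eventually_ge_atTop (n : ℝ))).exists
    obtain ⟨a, ha⟩ := lt_iSup_iff.1 (not_le.1 ht)
    exact ⟨t, a, hnt, a.2, ha⟩
  choose t y ht hyS hy using hbad
  obtain ⟨φ, z, hφ, hz⟩ := hcomp y hyS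
  have hzK : z ∈ omega0Fam K :=
    (isClosed_omega0Fam K).mem_of_tendsto hz (Eventually.of_forall fun n => hS (hyS _))
  have htφ : Tendsto (t ∘ φ) atTop atTop :=
    (tendsto_atTop_mono ht tendsto_natCast_atTop_atTop).comp hφ.tendsto_atTop
  have hlim : Tendsto (fun n => Metric.infEDist z (K (t (φ n))) + edist (y (φ n)) z)
      atTop (𝓝 0) := by
    have hzK' : Tendsto (fun t => Metric.infEDist z (K t)) atTop (𝓝 0) := hzK
    simpa using (hzK'.comp htφ).add (tendsto_iff_edist_tendsto_0.1 hz)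
  obtain ⟨n, hn⟩ := (hlim.eventually (gt_mem_nhds hε)).exists
  exact (hy (φ n)).not_ge (Metric.infEDist_le_infEDist_add_edist.trans hn.le)

/-- For a forward asymptotically compact multivalued process `U`
with pullback attractor `A`: `ω_f(B,t₀) ⊆ ω₀(A)` for all bounded `B` and all
`t₀` iff `dist(A_min, A(t)) → 0` as `t → +∞`. -/
theorem mOmega0_condition_iff_Amin [CompleteSpace X]
    (U : ℝ → ℝ → X → Set X) (hU : IsMultiProcess U)
    (A : ℝ → Set X) (hA : MIsPullbackAttractor U A)
    (hFC : MFwdAsympCompact U) :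
    (∀ B : Set X, IsBounded B → ∀ t₀ : ℝ, MomegaF U B t₀ ⊆ omega0Fam A) ↔
      Tendsto (fun t => esemidist (MAmin U) (A t)) atTop (𝓝 0) := by
  obtain ⟨-, hAc, hAinv, -, -⟩ := hA
  constructor
  · intro h
    have hsub : MAmin U ⊆ omega0Fam A :=
      closure_minimal (iUnion₂_subset fun B hB => iUnion_subset (h B hB)) (isClosed_omega0Fam A)
    exact tendsto_esemidist_of_subset_omega0Fam hsub fun y hy =>
      exists_tendsto_subseq_of_mem_omega0Fam (hAc 0).isBounded hAinv hFC fun n => hsub (hy n)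
  · intro h B hB t₀ y hy
    have hyA : y ∈ MAmin U :=
      subset_closure (mem_iUnion₂.2 ⟨B, hB, mem_iUnion.2 ⟨t₀, hy⟩⟩)
    exact tendsto_of_tendsto_of_tendsto_of_le_of_le tendsto_const_nhds h (fun _ => zero_le)
      fun t => le_iSup (fun a : MAmin U => Metric.infEDist (a : X) (A t)) ⟨y, hyA⟩
end

section
/- Let λ > 0 and let b : ℝ → ℝ be a continuous function with 0 < b₀ ≤ b(t) ≤ b₁ for all t ∈ ℝ. Define ξ(t) = ∫_{−∞}^{t} e^{−λ(t−s)} b(s) ds. Fix t₀ ∈ ℝ, R > 0, and x ∈ ℝ with |x| ≤ R, and define u(t) = e^{−λ(t−t₀)} x + ∫_{t₀}^{t} e^{−λ(t−s)} b(s) ds for t ≥ t₀. Then |u(t) − ξ(t)| ≤ e^{−λ(t−t₀)} R + e^{−λt} ∫_{−∞}^{t₀} e^{λs} b(s) ds for all t ≥ t₀; in particular |u(t) − ξ(t)| → 0 as t → +∞. -/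
open Filter Topology Set MeasureTheory Real

/-- A bounded continuous function times `s ↦ e^{as}`, `a > 0`, is integrable at `-∞`. -/
theorem integrableOn_exp_mul_mul_Iic {a C : ℝ} {b : ℝ → ℝ} (ha : 0 < a) (hb : Continuous b)
    (hC : ∀ s, |b s| ≤ C) (t : ℝ) :
    IntegrableOn (fun s => Real.exp (a * s) * b s) (Set.Iic t) :=
  (integrableOn_exp_mul_Iic ha t).mul_bdd hb.aestronglyMeasurable
    (Filter.Eventually.of_forall hC)

/-- With `λ > 0`, `b` continuous, `0 < b₀ ≤ b(t) ≤ b₁`,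
`ξ(t) = ∫_{−∞}^{t} e^{−λ(t−s)} b(s) ds`, `|x| ≤ R` and
`u(t) = e^{−λ(t−t₀)} x + ∫_{t₀}^{t} e^{−λ(t−s)} b(s) ds` for `t ≥ t₀`, one has
`|u(t) − ξ(t)| ≤ e^{−λ(t−t₀)} R + e^{−λt} ∫_{−∞}^{t₀} e^{λs} b(s) ds` for all
`t ≥ t₀`; in particular `|u(t) − ξ(t)| → 0` as `t → +∞`. -/
theorem solution_tendsto_xiM
    (lam b₀ b₁ R t₀ x : ℝ) (b : ℝ → ℝ) (hlam : 0 < lam)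
    (hb : Continuous b) (hb₀ : 0 < b₀)
    (hbl : ∀ t, b₀ ≤ b t) (hbu : ∀ t, b t ≤ b₁)
    (hR : 0 < R) (hx : |x| ≤ R)
    (u ξ : ℝ → ℝ)
    (hu : ∀ t, u t =
      Real.exp (-lam * (t - t₀)) * x + ∫ s in t₀..t, Real.exp (-lam * (t - s)) * b s)
    (hxi : ∀ t, ξ t = ∫ s in Set.Iic t, Real.exp (-lam * (t - s)) * b s) :
    (∀ t, t₀ ≤ t → |u t - ξ t| ≤ Real.exp (-lam * (t - t₀)) * R +
        Real.exp (-lam * t) * ∫ s in Set.Iic t₀, Real.exp (lam * s) * b s) ∧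
    Tendsto (fun t => |u t - ξ t|) atTop (𝓝 0) := by
  have hb_abs : ∀ s, |b s| ≤ b₁ := fun s => by
    rw [abs_of_pos (hb₀.trans_le (hbl s))]
    exact hbu s
  have hint := integrableOn_exp_mul_mul_Iic hlam hb hb_abs
  set I := ∫ s in Set.Iic t₀, Real.exp (lam * s) * b s with hI
  have hI_nonneg : 0 ≤ I :=
    integral_nonneg fun s => mul_nonneg (Real.exp_pos _).le (hb₀.le.trans (hbl s))
  have hfactor : ∀ t s, Real.exp (-lam * (t - s)) * b s =
      Real.exp (-lam * t) * (Real.exp (lam * s) * b s) := fun t s => by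
    rw [← mul_assoc, ← Real.exp_add]
    ring_nf
  have hdiff : ∀ t, u t - ξ t = Real.exp (-lam * (t - t₀)) * x - Real.exp (-lam * t) * I := by
    intro t
    simp only [hu, hxi, hfactor]
    rw [intervalIntegral.integral_const_mul, integral_const_mul,
      ← intervalIntegral.integral_Iic_sub_Iic (hint t₀) (hint t), ← hI]
    ring
  have hbound : ∀ t, |u t - ξ t| ≤ Real.exp (-lam * (t - t₀)) * R + Real.exp (-lam * t) * I := by
    intro t
    rw [hdiff]
    refine (abs_sub _ _).trans (add_le_add ?_ ?_)
    · rw [abs_mul, Real.abs_exp]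
      gcongr
    · rw [abs_of_nonneg (mul_nonneg (Real.exp_pos _).le hI_nonneg)]
  have hdecay : ∀ c, Tendsto (fun t => Real.exp (-lam * (t - c))) atTop (𝓝 0) := fun c =>
    Real.tendsto_exp_atBot.comp
      ((tendsto_atTop_add_const_right _ (-c) tendsto_id).const_mul_atTop_of_neg
        (neg_neg_of_pos hlam))
  refine ⟨fun t _ => hbound t, squeeze_zero (fun t => abs_nonneg _) hbound ?_⟩
  simpa using ((hdecay t₀).mul_const R).add ((hdecay 0).mul_const I)
end

section
/- Consider the process on ℝ defined by U(t,s,x) = t − 1 + e^{s−t}(x + 1 − s) for t ≥ s (the solution operator of the scalar ODE y' + y = t). Then for every r ∈ ℝ the family A_r(t) = {t − 1 + r e^{−t}} is invariant, i.e. U(t,s, s − 1 + r e^{−s}) = t − 1 + r e^{−t} for all t ≥ s, and forward attracts every bounded set: for every R > 0 and every t₀ ∈ ℝ, sup_{|x| ≤ R} |U(t,t₀,x) − (t − 1 + r e^{−t})| → 0 as t → +∞. Consequently there are infinitely many distinct forward attractors for this process. -/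
open Filter Topology Real

/-- For the process `U(t,s,x) = t − 1 + e^{s−t}(x + 1 − s)` on
`ℝ` (solution operator of `y' + y = t`), for every `r ∈ ℝ` the family
`A_r(t) = {t − 1 + r e^{−t}}` is invariant and forward attracts every bounded
set uniformly; moreover the map `r ↦ A_r` is injective with infinite range,
so there are infinitely many distinct forward attractors. -/
theorem infinitely_many_forward_attractors
    (U : ℝ → ℝ → ℝ → ℝ)
    (hU : ∀ t s x : ℝ, U t s x = t - 1 + Real.exp (s - t) * (x + 1 - s)) :
    (∀ r t s : ℝ, s ≤ t →
        U t s (s - 1 + r * Real.exp (-s)) = t - 1 + r * Real.exp (-t)) ∧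
    (∀ r R t₀ : ℝ, 0 < R →
        Tendsto (fun t => ⨆ x : {x : ℝ // |x| ≤ R},
            |U t t₀ (x : ℝ) - (t - 1 + r * Real.exp (-t))|) atTop (𝓝 0)) ∧
    Function.Injective (fun r : ℝ => fun t : ℝ => t - 1 + r * Real.exp (-t)) ∧
    Set.Infinite (Set.range (fun r : ℝ => fun t : ℝ => t - 1 + r * Real.exp (-t))) := by
  have hdiff : ∀ r t s x : ℝ, U t s x - (t - 1 + r * Real.exp (-t)) =
      Real.exp (-t) * (Real.exp s * (x + 1 - s) - r) := by
    intro r t s x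
    rw [hU, sub_eq_add_neg s t, Real.exp_add]
    ring
  have hinj : Function.Injective (fun r : ℝ => fun t : ℝ => t - 1 + r * Real.exp (-t)) := by
    intro r r' h
    simpa using congrFun h 0
  refine ⟨fun r t s _ => ?_, fun r R t₀ hR => ?_, hinj, Set.infinite_range_of_injective hinj⟩
  · have hs : Real.exp s * Real.exp (-s) = 1 := by rw [← Real.exp_add]; simp
    rw [← sub_eq_zero, hdiff]
    linear_combination r * Real.exp (-t) * hs
  · have hlim : Tendsto (fun t : ℝ => Real.exp (-t) *
        (Real.exp t₀ * (R + |1 - t₀|) + |r|)) atTop (𝓝 0) := by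
      simpa using Real.tendsto_exp_neg_atTop_nhds_zero.mul_const
        (Real.exp t₀ * (R + |1 - t₀|) + |r|)
    refine squeeze_zero (fun t => Real.iSup_nonneg fun x => abs_nonneg _)
      (fun t => Real.iSup_le (fun x => ?_) (by positivity)) hlim
    rw [hdiff, abs_mul, Real.abs_exp]
    gcongr
    refine (abs_sub _ _).trans ?_
    rw [abs_mul, Real.abs_exp, add_sub_assoc]
    gcongr
    exact (abs_add_le _ _).trans (by gcongr; exact x.2)
end
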